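/- For every δ > 0 there exists an element ψ ∈ G(ℝ^d) such that ∫ψ(x)dx = 1 in R̃, ∫x^β ψ(x)dx = 0 in R̃ for every multi-index β with |β| ≥ 1, supp ψ ⊆ {x∈ℝ^d : |x| ≤ 1}, and in addition ∫|ψ(x)|dx ≤ 1 + δ in R̃. Concretely: there exists a moderate net (ψ_ε)_ε of smooth functions ψ_ε ∈ C^∞(ℝ^d), each supported in the closed unit ball {|x| ≤ 1}, such that (∫ψ_ε(x)dx − 1)_ε is negligible, (∫x^β ψ_ε(x)dx)_ε is negligible for every |β| ≥ 1, and ∫|ψ_ε(x)|dx ≤ 1 + δ for all sufficiently small ε. -/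

import Mathlib

open Filter Topology MeasureTheory

/-- A negligible net of real numbers. -/
def IsNegligibleR (n : ℝ → ℝ) : Prop :=
  ∀ m : ℕ, ∀ᶠ ε in 𝓝[>] (0 : ℝ), |n ε| ≤ ε ^ m

/-- A net of smooth functions on `ℝ^d`, moderate in the sense of the Colombeau algebra
`𝒢(ℝ^d)`: on every compact set, every derivative grows at most like some `ε^{-M}`. -/
def GModerate {d : ℕ} (f : ℝ → EuclideanSpace ℝ (Fin d) → ℝ) : Prop :=
  ∀ K : Set (EuclideanSpace ℝ (Fin d)), IsCompact K → ∀ j : ℕ, ∃ M : ℕ,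
    ∀ᶠ ε in 𝓝[>] (0 : ℝ), ∀ x ∈ K, ‖iteratedFDeriv ℝ j (f ε) x‖ ≤ ε ^ (-(M : ℤ))


/-- smooth, supported in the unit ball, with moments of order `1..q` vanishing and small `L¹` norm -/
def GoodMoll (d : ℕ) (δ : ℝ) (q : ℕ) (φ : EuclideanSpace ℝ (Fin d) → ℝ) : Prop :=
  ContDiff ℝ (⊤ : ℕ∞) φ ∧ Function.support φ ⊆ Metric.closedBall 0 1 ∧
  (∫ x, φ x) = 1 ∧
  (∀ β : Fin d → ℕ, 1 ≤ ∑ i, β i → ∑ i, β i ≤ q → ∫ x, (∏ i, (x i) ^ (β i)) * φ x = 0) ∧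
  (∫ x, |φ x|) < 1 + δ

lemma hasCompactSupport_of_support_ball {d : ℕ} {φ : EuclideanSpace ℝ (Fin d) → ℝ}
    (h : Function.support φ ⊆ Metric.closedBall 0 1) : HasCompactSupport φ :=
  HasCompactSupport.of_support_subset_isCompact (isCompact_closedBall 0 1) h

lemma integrable_moment {d : ℕ} {φ : EuclideanSpace ℝ (Fin d) → ℝ} (hc : Continuous φ)
    (h : HasCompactSupport φ) (β : Fin d → ℕ) :
    Integrable (fun x : EuclideanSpace ℝ (Fin d) => (∏ i, (x i) ^ (β i)) * φ x) := by
  apply Continuous.integrable_of_hasCompactSupport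
  · fun_prop
  · exact h.mul_left

lemma moment_scale {d : ℕ} (φ : EuclideanSpace ℝ (Fin d) → ℝ) (β : Fin d → ℕ) {R : ℝ}
    (hR : 1 < R) :
    R ^ (∑ i, β i) * (R ^ d * ∫ x : EuclideanSpace ℝ (Fin d), (∏ i, (x i) ^ (β i)) * φ (R • x))
      = ∫ x : EuclideanSpace ℝ (Fin d), (∏ i, (x i) ^ (β i)) * φ x := by
  have hR0 : 0 < R := by linarith
  have h1 := Measure.integral_comp_smul (volume : Measure (EuclideanSpace ℝ (Fin d)))
    (fun x : EuclideanSpace ℝ (Fin d) => (∏ i, (x i) ^ (β i)) * φ x) R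
  have h2 : ∀ x : EuclideanSpace ℝ (Fin d), (∏ i, ((R • x) i) ^ (β i)) * φ (R • x)
      = R ^ (∑ i, β i) * ((∏ i, (x i) ^ (β i)) * φ (R • x)) := by
    intro x
    have : ∏ i, ((R • x) i) ^ (β i) = R ^ (∑ i, β i) * ∏ i, (x i) ^ (β i) := by
      rw [← Finset.prod_pow_eq_pow_sum, ← Finset.prod_mul_distrib]
      refine Finset.prod_congr rfl fun i _ => ?_
      rw [← mul_pow]; rfl
    rw [this]; ring
  simp only [h2] at h1
  rw [integral_const_mul, finrank_euclideanSpace_fin, abs_of_pos (by positivity), smul_eq_mul] at h1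
  have h3 : R ^ d ≠ 0 := by positivity
  calc _ = R ^ d * (R ^ (∑ i, β i) * ∫ x : EuclideanSpace ℝ (Fin d), (∏ i, (x i) ^ (β i)) * φ (R • x)) := by ring
    _ = _ := by rw [h1]; field_simp

lemma goodMoll_zero (d : ℕ) (δ : ℝ) (hδ : 0 < δ) : ∃ φ, GoodMoll d δ 0 φ := by
  let b : ContDiffBump (0 : EuclideanSpace ℝ (Fin d)) := ⟨1/2, 1, by norm_num, by norm_num⟩
  refine ⟨b.normed volume, b.contDiff_normed, ?_, b.integral_normed, ?_, ?_⟩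
  · rw [b.support_normed_eq]; exact Metric.ball_subset_closedBall
  · intro β h1 h2; omega
  · have : ∀ x, |b.normed volume x| = b.normed volume x := fun x => abs_of_nonneg (b.nonneg_normed x)
    simp only [this, b.integral_normed]; linarith

lemma goodMoll_succ (d : ℕ) (δ : ℝ) (q : ℕ) (h : ∃ φ, GoodMoll d δ q φ) :
    ∃ φ, GoodMoll d δ (q + 1) φ := by
  obtain ⟨φ, hs, hsup, hint, hmom, hl1⟩ := h
  have hcs := hasCompactSupport_of_support_ball hsup
  have hc := hs.continuous
  set A := ∫ x, |φ x| with hA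
  have hA0 : 0 ≤ A := integral_nonneg fun x => abs_nonneg _
  -- choose R
  obtain ⟨R, hR1, hR⟩ : ∃ R : ℝ, 1 < R ∧ A * (R ^ (q+1) + 1) < (1 + δ) * (R ^ (q+1) - 1) := by
    have ht : Tendsto (fun R : ℝ => (1 + δ - A) * R ^ (q+1)) atTop atTop :=
      (tendsto_pow_atTop (by omega)).const_mul_atTop (by linarith)
    obtain ⟨R, h1, h2⟩ := ((ht.eventually_gt_atTop (A + 1 + δ)).and (eventually_gt_atTop 1)).exists
    exact ⟨R, h2, by linarith⟩
  have hR0 : 0 < R := by linarith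
  have hP : 1 < R ^ (q+1) := one_lt_pow₀ hR1 (by omega)
  set P := R ^ (q+1) with hPdef
  have hP1 : 0 < P - 1 := by linarith
  have hsR : ContDiff ℝ (⊤ : ℕ∞) (fun x => φ (R • x)) := hs.comp (contDiff_const_smul R)
  have hsupR : Function.support (fun x => φ (R • x)) ⊆ Metric.closedBall 0 1 := by
    intro x hx
    have := hsup (show R • x ∈ Function.support φ from hx)
    rw [mem_closedBall_zero_iff, norm_smul, Real.norm_of_nonneg hR0.le] at this
    rw [mem_closedBall_zero_iff]
    nlinarith [norm_nonneg x]
  have hcsR := hasCompactSupport_of_support_ball hsupR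
  have hcR := hsR.continuous
  have key : ∀ β : Fin d → ℕ,
      ∫ x : EuclideanSpace ℝ (Fin d), (∏ i, (x i) ^ (β i)) * ((P * R ^ d * φ (R • x) - φ x) / (P - 1))
       = (P / R ^ (∑ i, β i) - 1) / (P - 1) * ∫ x : EuclideanSpace ℝ (Fin d), (∏ i, (x i) ^ (β i)) * φ x := by
    intro β
    have e : ∀ x : EuclideanSpace ℝ (Fin d), (∏ i, (x i) ^ (β i)) * ((P * R ^ d * φ (R • x) - φ x) / (P - 1))
      = (P - 1)⁻¹ * (P * R ^ d * ((∏ i, (x i) ^ (β i)) * φ (R • x)) - (∏ i, (x i) ^ (β i)) * φ x) := by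
      intro x; ring
    simp only [e]
    rw [integral_const_mul, integral_sub ((integrable_moment hcR hcsR β).const_mul _)
      (integrable_moment hc hcs β), integral_const_mul, ← moment_scale φ β hR1]
    have : R ^ (∑ i, β i) ≠ 0 := by positivity
    field_simp
  refine ⟨fun x => (P * R ^ d * φ (R • x) - φ x) / (P - 1), ?_, ?_, ?_, ?_, ?_⟩
  · exact ((contDiff_const.mul hsR).sub hs).div_const _
  · intro x hx
    by_contra hx'
    have h1 : φ x = 0 := by by_contra h; exact hx' (hsup h)
    have h2 : φ (R • x) = 0 := by by_contra h; exact hx' (hsupR h)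
    simp [h1, h2] at hx
  · have := key 0
    simp only [Pi.zero_apply, pow_zero, Finset.prod_const_one, one_mul, Finset.sum_const_zero, hint] at this
    rw [this]; field_simp
  · intro β h1 h2
    rw [key β]
    rcases Nat.lt_or_ge q (∑ i, β i) with h | h
    · have : ∑ i, β i = q + 1 := by omega
      rw [this, ← hPdef, div_self (by linarith)]; simp
    · rw [hmom β h1 h]; simp
  · have hi1 : Integrable (fun x => |φ (R • x)|) :=
      (hcR.integrable_of_hasCompactSupport hcsR).abs
    have hi2 : Integrable (fun x => |φ x|) := (hc.integrable_of_hasCompactSupport hcs).abs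
    have hAR : R ^ d * ∫ x, |φ (R • x)| = A := by
      have := moment_scale (fun x => |φ x|) 0 hR1
      simpa using this
    have hle : ∫ x, |(P * R ^ d * φ (R • x) - φ x) / (P - 1)|
        ≤ ∫ x, (P - 1)⁻¹ * (P * R ^ d * |φ (R • x)| + |φ x|) := by
      refine integral_mono_of_nonneg (Eventually.of_forall fun x => abs_nonneg _)
        (((hi1.const_mul _).add hi2).const_mul _) (Eventually.of_forall fun x => ?_)
      show |(P * R ^ d * φ (R • x) - φ x) / (P - 1)| ≤ (P - 1)⁻¹ * (P * R ^ d * |φ (R • x)| + |φ x|)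
      rw [abs_div, abs_of_pos hP1, div_eq_inv_mul]
      gcongr
      refine (abs_sub _ _).trans ?_
      rw [abs_mul, abs_of_pos (show 0 < P * R ^ d by positivity)]
    refine hle.trans_lt ?_
    rw [integral_const_mul, integral_add (hi1.const_mul _) hi2, integral_const_mul, mul_assoc, hAR,
      ← hA, inv_mul_lt_iff₀ hP1]
    linarith

lemma goodMoll_exists (d : ℕ) (δ : ℝ) (hδ : 0 < δ) (q : ℕ) : ∃ φ, GoodMoll d δ q φ := by
  induction q with
  | zero => exact goodMoll_zero d δ hδ
  | succ q ih => exact goodMoll_succ d δ q ih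

lemma goodMoll_bound {d : ℕ} {φ : EuclideanSpace ℝ (Fin d) → ℝ} (hs : ContDiff ℝ (⊤ : ℕ∞) φ)
    (hcs : HasCompactSupport φ) (q : ℕ) :
    ∃ C : ℝ, ∀ j ≤ q, ∀ x, ‖iteratedFDeriv ℝ j φ x‖ ≤ C := by
  have : ∀ j : ℕ, ∃ C : ℝ, ∀ x, ‖iteratedFDeriv ℝ j φ x‖ ≤ C := fun j =>
    (hs.continuous_iteratedFDeriv (m := j) (by exact_mod_cast le_top)).bounded_above_of_compact_support
      (hcs.iteratedFDeriv j)
  choose C hC using this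
  refine ⟨∑ j ∈ Finset.range (q+1), C j, fun j hj x => (hC j x).trans ?_⟩
  exact Finset.single_le_sum (f := C) (fun i _ => (norm_nonneg _).trans (hC i x))
    (Finset.mem_range.2 (by omega))

/-- For every `δ > 0` there is a generalized mollifier `ψ ∈ 𝒢(ℝ^d)` as in
Statement 16 which in addition satisfies `∫ |ψ(x)| dx ≤ 1 + δ` in `ℝ̃`. -/
theorem exists_generalized_mollifier_l1_bound (d : ℕ) (δ : ℝ) (hδ : 0 < δ) :
    ∃ ψ : ℝ → EuclideanSpace ℝ (Fin d) → ℝ,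
      (∀ ε, ContDiff ℝ (⊤ : ℕ∞) (ψ ε)) ∧
      (∀ ε, Function.support (ψ ε) ⊆ Metric.closedBall 0 1) ∧
      GModerate ψ ∧
      IsNegligibleR (fun ε => (∫ x, ψ ε x) - 1) ∧
      (∀ β : Fin d → ℕ, 1 ≤ ∑ i, β i →
        IsNegligibleR (fun ε => ∫ x, (∏ i, (x i) ^ (β i)) * ψ ε x)) ∧
      (∀ᶠ ε in 𝓝[>] (0 : ℝ), (∫ x, |ψ ε x|) ≤ 1 + δ) := by
  choose φ hφ using goodMoll_exists d δ hδ
  have hb : ∀ q, ∃ C : ℝ, ∀ j ≤ q, ∀ x, ‖iteratedFDeriv ℝ j (φ q) x‖ ≤ C := fun q =>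
    goodMoll_bound (hφ q).1 (hasCompactSupport_of_support_ball (hφ q).2.1) q
  choose C hC using hb
  classical
  let Q : ℝ → ℕ := fun ε => Nat.findGreatest (fun n => C n ≤ ε⁻¹) ⌊ε⁻¹⌋₊
  have hinv : ∀ c : ℝ, ∀ᶠ ε in 𝓝[>] (0 : ℝ), c ≤ ε⁻¹ := fun c =>
    tendsto_inv_nhdsGT_zero.eventually_ge_atTop c
  have hQ : ∀ N : ℕ, ∀ᶠ ε in 𝓝[>] (0 : ℝ), N ≤ Q ε := by
    intro N
    filter_upwards [hinv N, hinv (C N)] with ε h1 h2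
    exact Nat.le_findGreatest (Nat.le_floor h1) h2
  have hCQ : ∀ᶠ ε in 𝓝[>] (0 : ℝ), C (Q ε) ≤ ε⁻¹ := by
    filter_upwards [hinv (C 0)] with ε h
    exact Nat.findGreatest_spec (P := fun n => C n ≤ ε⁻¹) (Nat.zero_le _) h
  refine ⟨fun ε => φ (Q ε), fun ε => (hφ _).1, fun ε => (hφ _).2.1, ?_, ?_, ?_, ?_⟩
  · intro K _ j
    refine ⟨1, ?_⟩
    filter_upwards [hQ j, hCQ] with ε h1 h2 x _
    refine (hC _ j h1 x).trans (h2.trans_eq ?_)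
    simp
  · intro m
    filter_upwards [self_mem_nhdsWithin] with ε hε
    rw [(hφ (Q ε)).2.2.1, sub_self, abs_zero]
    exact pow_nonneg (le_of_lt hε) m
  · intro β hβ m
    filter_upwards [self_mem_nhdsWithin, hQ (∑ i, β i)] with ε hε h1
    rw [(hφ (Q ε)).2.2.2.1 β hβ h1, abs_zero]
    exact pow_nonneg (le_of_lt hε) m
  · exact Eventually.of_forall fun ε => (hφ (Q ε)).2.2.2.2.le
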